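/- An X state with real off-diagonal entries e, f and diagonal a,b,c,d satisfying √(ad) = √(bc) and |e| ≤ √(ad), |f| ≤ √(bc) is separable. -/

import Mathlib

open Matrix ComplexOrder Kronecker

/-- A two-qubit X state (as a 4×4 complex matrix). -/
noncomputable def Xmat (a b c d e f : ℝ) : Matrix (Fin 4) (Fin 4) ℂ :=
  !![(a : ℂ), 0, 0, (e : ℂ);
     0, (b : ℂ), (f : ℂ), 0;
     0, (f : ℂ), (c : ℂ), 0;
     (e : ℂ), 0, 0, (d : ℂ)]

/-- The 4×4 matrix of the two-qubit product state `A ⊗ B`. -/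
noncomputable def prodMat (A B : Matrix (Fin 2) (Fin 2) ℂ) : Matrix (Fin 4) (Fin 4) ℂ :=
  Matrix.reindex finProdFinEquiv finProdFinEquiv (A ⊗ₖ B)

/-- A two-qubit state is separable if it is a convex combination of product states. -/
def SeparableState (ρ : Matrix (Fin 4) (Fin 4) ℂ) : Prop :=
  ∃ (k : ℕ) (w : Fin k → ℝ) (A B : Fin k → Matrix (Fin 2) (Fin 2) ℂ),
    (∀ i, 0 ≤ w i) ∧ (∑ i, w i = 1) ∧
    (∀ i, (A i).PosSemidef ∧ (A i).trace = 1) ∧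
    (∀ i, (B i).PosSemidef ∧ (B i).trace = 1) ∧
    ρ = ∑ i, ((w i : ℝ) : ℂ) • prodMat (A i) (B i)

/-- The pure qubit state with amplitudes `x` and `x' * (c + s * I)`. -/
noncomputable def pureQubit (x x' c s : ℝ) : Matrix (Fin 2) (Fin 2) ℂ :=
  !![(x : ℂ) ^ 2, x * x' * (c - s * Complex.I);
     x * x' * (c + s * Complex.I), (x' : ℂ) ^ 2]

theorem pureQubit_posSemidef {x x' c s : ℝ} (h : c ^ 2 + s ^ 2 = 1) :
    (pureQubit x x' c s).PosSemidef := by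
  have h' : (c : ℂ) ^ 2 + (s : ℂ) ^ 2 = 1 := by exact_mod_cast h
  have key : pureQubit x x' c s =
      vecMulVec ![(x : ℂ), x' * (c + s * Complex.I)]
        (star ![(x : ℂ), x' * (c + s * Complex.I)]) := by
    ext i j
    fin_cases i <;> fin_cases j <;> simp [pureQubit, vecMulVec_apply]
    · ring
    · ring
    · ring
    · linear_combination (-(x' : ℂ) ^ 2) * h' + (x' : ℂ) ^ 2 * (s : ℂ) ^ 2 * Complex.I_sq
  rw [key]
  exact posSemidef_vecMulVec_self_star _

theorem pureQubit_trace {x x' : ℝ} (c s : ℝ) (h : x ^ 2 + x' ^ 2 = 1) :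
    (pureQubit x x' c s).trace = 1 := by
  simp only [pureQubit, trace_fin_two_of]
  exact_mod_cast h

theorem prodMat_eq (A B : Matrix (Fin 2) (Fin 2) ℂ) :
    prodMat A B =
      !![A 0 0 * B 0 0, A 0 0 * B 0 1, A 0 1 * B 0 0, A 0 1 * B 0 1;
         A 0 0 * B 1 0, A 0 0 * B 1 1, A 0 1 * B 1 0, A 0 1 * B 1 1;
         A 1 0 * B 0 0, A 1 0 * B 0 1, A 1 1 * B 0 0, A 1 1 * B 0 1;
         A 1 0 * B 1 0, A 1 0 * B 1 1, A 1 1 * B 1 0, A 1 1 * B 1 1] := by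
  ext i j
  fin_cases i <;> fin_cases j <;> rfl

/-- Averaging a product of pure qubit states over complex conjugation and over a simultaneous sign
change of the phases yields an X state. -/
theorem separableState_Xmat_of_phases {x x' y y' c s c' s' : ℝ}
    (hx : x ^ 2 + x' ^ 2 = 1) (hy : y ^ 2 + y' ^ 2 = 1)
    (hc : c ^ 2 + s ^ 2 = 1) (hc' : c' ^ 2 + s' ^ 2 = 1) :
    SeparableState (Xmat (x ^ 2 * y ^ 2) (x ^ 2 * y' ^ 2) (x' ^ 2 * y ^ 2) (x' ^ 2 * y' ^ 2)
      (x * x' * (y * y') * (c * c' - s * s')) (x * x' * (y * y') * (c * c' + s * s'))) := by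
  refine ⟨4, fun _ => 1 / 4,
    ![pureQubit x x' c s, pureQubit x x' c (-s), pureQubit x x' (-c) (-s), pureQubit x x' (-c) s],
    ![pureQubit y y' c' s', pureQubit y y' c' (-s'), pureQubit y y' (-c') (-s'),
      pureQubit y y' (-c') s'], fun _ => by norm_num, by norm_num, ?_, ?_, ?_⟩
  · intro i
    fin_cases i <;> exact ⟨pureQubit_posSemidef (by simpa using hc), pureQubit_trace _ _ hx⟩
  · intro i
    fin_cases i <;> exact ⟨pureQubit_posSemidef (by simpa using hc'), pureQubit_trace _ _ hy⟩
  · simp only [Fin.sum_univ_four, prodMat_eq]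
    ext i j
    fin_cases i <;> fin_cases j <;> simp [Xmat, pureQubit] <;> ring_nf <;>
      simp only [Complex.I_sq] <;> ring

/-- An X state with real off-diagonal entries `e, f` satisfying `√(ad) = √(bc)`,
`|e| ≤ √(ad)` and `|f| ≤ √(bc)` is separable. -/
theorem Xstate_separable_of_sqrt_eq (a b c d e f : ℝ)
    (hρ : (Xmat a b c d e f).PosSemidef) (htr : (Xmat a b c d e f).trace = 1)
    (heq : Real.sqrt (a * d) = Real.sqrt (b * c))
    (he : |e| ≤ Real.sqrt (a * d)) (hf : |f| ≤ Real.sqrt (b * c)) :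
    SeparableState (Xmat a b c d e f) := by
  have hnn (i : Fin 4) := hρ.diag_nonneg (i := i)
  have ha : 0 ≤ a := by simpa [Xmat] using hnn 0
  have hb : 0 ≤ b := by simpa [Xmat] using hnn 1
  have hc : 0 ≤ c := by simpa [Xmat] using hnn 2
  have hd : 0 ≤ d := by simpa [Xmat] using hnn 3
  have hsum : a + b + c + d = 1 := by
    simp only [Xmat, trace, Fin.sum_univ_four, diag] at htr
    simpa [← Complex.ofReal_add] using (congrArg Complex.re htr)
  have hdet : a * d = b * c := (Real.sqrt_inj (mul_nonneg ha hd) (mul_nonneg hb hc)).1 heq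
  rw [← heq] at hf
  have exists_cos {r t : ℝ} (h : |t| ≤ r) : ∃ θ : ℝ, t = r * Real.cos θ := by
    have hr : 0 ≤ r := (abs_nonneg t).trans h
    obtain ⟨h₁, h₂⟩ := abs_le.1 (abs_div t r ▸ abs_of_nonneg hr ▸ div_le_one_of_le₀ h hr)
    refine ⟨Real.arccos (t / r), ?_⟩
    rw [Real.cos_arccos h₁ h₂]
    rcases hr.eq_or_lt with rfl | hr
    · simpa using h
    · field_simp
  obtain ⟨α, hα⟩ := exists_cos he
  obtain ⟨β, hβ⟩ := exists_cos hf
  have hsq {t : ℝ} (ht : 0 ≤ t) : √t ^ 2 = t := Real.sq_sqrt ht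
  have hab := hsq (add_nonneg ha hb)
  have hcd := hsq (add_nonneg hc hd)
  have hac := hsq (add_nonneg ha hc)
  have hbd := hsq (add_nonneg hb hd)
  have hs : √(a * d) = √(a + b) * √(c + d) * (√(a + c) * √(b + d)) := by
    rw [Real.sqrt_eq_iff_mul_self_eq (by positivity) (by positivity), eq_comm]
    calc _ = √(a + b) ^ 2 * √(c + d) ^ 2 * (√(a + c) ^ 2 * √(b + d) ^ 2) := by ring
      _ = ((a + b) * (a + c)) * ((c + d) * (b + d)) := by rw [hab, hcd, hac, hbd]; ring
      _ = a * d := by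
        rw [show (a + b) * (a + c) = a by linear_combination a * hsum - hdet,
          show (c + d) * (b + d) = d by linear_combination d * hsum - hdet]
  have key := separableState_Xmat_of_phases (x := √(a + b)) (x' := √(c + d)) (y := √(a + c))
    (y' := √(b + d)) (by rw [hab, hcd]; linarith) (by rw [hac, hbd]; linarith)
    (Real.cos_sq_add_sin_sq ((α + β) / 2)) (Real.cos_sq_add_sin_sq ((α - β) / 2))
  rw [← Real.cos_add, ← Real.cos_sub, ← hs, hab, hcd, hac, hbd,
    show (α + β) / 2 + (α - β) / 2 = α by ring, show (α + β) / 2 - (α - β) / 2 = β by ring,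
    ← hα, ← hβ, show (a + b) * (a + c) = a by linear_combination a * hsum - hdet,
    show (a + b) * (b + d) = b by linear_combination b * hsum + hdet,
    show (c + d) * (a + c) = c by linear_combination c * hsum + hdet,
    show (c + d) * (b + d) = d by linear_combination d * hsum - hdet] at key
  exact key
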